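/- arXiv:2605.01579 — 6 statements merged into one kernel-verified Lean document; each statement's English description precedes it below -/
import Mathlib

section
/- Suppose S = {0,1}^K, τ̂(s) = τ0 + Σ_{k=1}^K s_k δ_k with constant confidence half-width c > 0, τ0 > c, and max_k |δ_k| ≤ 2c. Let 𝒦⁻ = {k : τ0 δ_k < 0} with K⁻ = |𝒦⁻|, and order the opposing axes so that |δ_{π(1)}| ≥ ⋯ ≥ |δ_{π(K⁻)}|. If there exists m ∈ {1,…,K⁻} with Σ_{j=1}^m |δ_{π(j)}| ≥ τ0 − c, then MSP(S, N(S)) equals the smallest such m; if no such m exists, then MSP(S, N(S)) = ∞ (i.e., N(S) = ∅). -/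
/-- Minimum specification perturbation: the least Hamming weight (cardinality)
of a feasible specification, or `⊤` if the feasible set is empty. -/
noncomputable def MSP {K : ℕ} (F : Set (Finset (Fin K))) : ℕ∞ :=
  ⨅ s ∈ F, (s.card : ℕ∞)

/-- Greedy prefix sum of the magnitudes of opposing shifts:
`D r = ∑_{j=1}^r |δ_{π(j)}|` (with `π` zero-indexed). -/
def Dsum {K : ℕ} (δ : Fin K → ℝ) (π : ℕ → Fin K) (r : ℕ) : ℝ :=
  ∑ j ∈ Finset.range r, |δ (π j)|

/-- For a function antitone on `[0, n)`, a sum over a subset of `[0, n)` is at most the sum over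
the initial segment of the same cardinality. -/
theorem Finset.sum_le_sum_range_card_of_antitone (f : ℕ → ℝ) (n : ℕ)
    (hf : ∀ i j, i ≤ j → j < n → f j ≤ f i) (T : Finset ℕ) (hT : T ⊆ Finset.range n) :
    ∑ j ∈ T, f j ≤ ∑ j ∈ Finset.range T.card, f j := by
  induction n generalizing T with
  | zero => simp [Finset.subset_empty.mp hT]
  | succ n ih =>
    have hT' : T.erase n ⊆ Finset.range n := by
      intro x hx
      have hxT := Finset.mem_range.mp (hT (Finset.mem_of_mem_erase hx))
      have hxn := Finset.ne_of_mem_erase hx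
      exact Finset.mem_range.mpr (by omega)
    have hsum := ih (fun i j hij hj => hf i j hij (by omega)) _ hT'
    by_cases hn : n ∈ T
    · have hcard : (T.erase n).card ≤ n := by simpa using Finset.card_le_card hT'
      have hlast := hf _ n hcard (by omega)
      rw [← Finset.card_erase_add_one hn, Finset.sum_range_succ, ← Finset.sum_erase_add _ _ hn]
      linarith
    · rwa [Finset.erase_eq_of_notMem hn] at hsum

/-- Every null-compatible specification has at least as many axes as some greedy prefix of
opposing axes that covers the distance `τ0 - c`. -/
theorem exists_prefix_le_card {K : ℕ} {τ0 c : ℝ} {δ : Fin K → ℝ} (hc : 0 < c) (hτ : c < τ0)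
    {Km : ℕ} {π : ℕ → Fin K}
    (hπinj : ∀ i j, i < Km → j < Km → π i = π j → i = j)
    (hπsurj : ∀ k : Fin K, τ0 * δ k < 0 → ∃ j, j < Km ∧ π j = k)
    (hsort : ∀ i j, i ≤ j → j < Km → |δ (π j)| ≤ |δ (π i)|)
    {s : Finset (Fin K)} (hs : |τ0 + ∑ k ∈ s, δ k| ≤ c) :
    ∃ m, (1 ≤ m ∧ m ≤ Km ∧ τ0 - c ≤ Dsum δ π m) ∧ m ≤ s.card := by
  let T := (Finset.range Km).filter (fun j => π j ∈ s)
  have hinj : Set.InjOn π T := by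
    intro i hi j hj hij
    simp only [T, Finset.coe_filter, Finset.mem_range, Set.mem_ofPred_eq] at hi hj
    exact hπinj i j hi.1 hj.1 hij
  have himage : T.image π ⊆ s := by
    simp +contextual [T, Finset.image_subset_iff]
  have hsub : T ⊆ Finset.range Km := Finset.filter_subset _ _
  have hle : -∑ k ∈ s, δ k ≤ ∑ j ∈ T, |δ (π j)| := by
    rw [← Finset.sum_image (f := fun k => |δ k|) hinj, ← Finset.sum_neg_distrib,
      ← Finset.sum_sdiff himage]
    have hout : ∑ k ∈ s \ T.image π, -δ k ≤ 0 := by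
      refine Finset.sum_nonpos fun k hk => ?_
      obtain ⟨hks, hkT⟩ := Finset.mem_sdiff.mp hk
      by_contra! hpos
      obtain ⟨j, hj, rfl⟩ := hπsurj k (by nlinarith)
      exact hkT (Finset.mem_image_of_mem π (by simp [T, hj, hks]))
    have hin : ∑ k ∈ T.image π, -δ k ≤ ∑ k ∈ T.image π, |δ k| :=
      Finset.sum_le_sum fun k _ => neg_le_abs (δ k)
    linarith
  have hD : τ0 - c ≤ Dsum δ π T.card := by
    have hgreedy := Finset.sum_le_sum_range_card_of_antitone (fun j => |δ (π j)|) Km hsort T hsub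
    have := (abs_le.mp hs).2
    simp only [Dsum]
    linarith
  refine ⟨T.card, ⟨?_, by simpa using Finset.card_le_card hsub, hD⟩, ?_⟩
  · by_contra! h
    rw [Nat.lt_one_iff.mp h] at hD
    simp only [Dsum, Finset.range_zero, Finset.sum_empty] at hD
    linarith
  · rw [← Finset.card_image_of_injOn hinj]
    exact Finset.card_le_card himage

/-- A minimal greedy prefix that covers the distance `τ0 - c` is null-compatible, because no
single step exceeds `2 * c`. -/
theorem abs_add_sum_image_range_le {K : ℕ} {τ0 c : ℝ} {δ : Fin K → ℝ} (hc : 0 < c) (hτ : c < τ0)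
    (hbound : ∀ k, |δ k| ≤ 2 * c) {Km : ℕ} {π : ℕ → Fin K}
    (hπmem : ∀ j, j < Km → τ0 * δ (π j) < 0) {m : ℕ}
    (hinj : Set.InjOn π (Finset.range m)) (hm : m ≤ Km) (hD : τ0 - c ≤ Dsum δ π m)
    (hmin : ∀ r < m, 1 ≤ r → Dsum δ π r < τ0 - c) :
    |τ0 + ∑ k ∈ (Finset.range m).image π, δ k| ≤ c := by
  have hsum : ∑ k ∈ (Finset.range m).image π, δ k = -Dsum δ π m := by
    rw [Finset.sum_image hinj, Dsum, ← Finset.sum_neg_distrib]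
    refine Finset.sum_congr rfl fun j hj => ?_
    have hneg := hπmem j ((Finset.mem_range.mp hj).trans_le hm)
    rw [abs_of_neg (by by_contra! h; nlinarith), neg_neg]
  have hupper : Dsum δ π m ≤ τ0 + c := by
    cases m with
    | zero => simp only [Dsum, Finset.range_zero, Finset.sum_empty]; linarith
    | succ r =>
      have hr : Dsum δ π r < τ0 - c := by
        rcases Nat.eq_zero_or_pos r with rfl | hr
        · simp only [Dsum, Finset.range_zero, Finset.sum_empty]; linarith
        · exact hmin r (by omega) hr
      have hstep : Dsum δ π (r + 1) = Dsum δ π r + |δ (π r)| := Finset.sum_range_succ _ _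
      linarith [hbound (π r)]
  rw [hsum, abs_le]
  constructor <;> linarith

/-- Additive characterization (Theorem 1): in the additive model
`τ̂(s) = τ0 + ∑_k s_k δ_k` with constant half-width `c`, `τ0 > c > 0`, and
bounded steps `max_k |δ_k| ≤ 2c`, with the opposing axes `{k : τ0 δ_k < 0}`
enumerated by `π` in decreasing order of `|δ_k|`, the MSP of the
null-compatible set `N(S) = {s : |τ̂(s)| ≤ c}` equals the smallest
`m ∈ {1,…,K⁻}` with `∑_{j=1}^m |δ_{π(j)}| ≥ τ0 - c` when such `m` exists,
and equals `∞` otherwise. -/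
theorem additive_characterization {K : ℕ} (τ0 c : ℝ) (δ : Fin K → ℝ)
    (hc : 0 < c) (hτ : c < τ0)
    (hbound : ∀ k, |δ k| ≤ 2 * c)
    (Km : ℕ) (hKm : Km = (Finset.univ.filter (fun k => τ0 * δ k < 0)).card)
    (π : ℕ → Fin K)
    (hπinj : ∀ i j, i < Km → j < Km → π i = π j → i = j)
    (hπmem : ∀ j, j < Km → τ0 * δ (π j) < 0)
    (hπsurj : ∀ k : Fin K, τ0 * δ k < 0 → ∃ j, j < Km ∧ π j = k)
    (hsort : ∀ i j, i ≤ j → j < Km → |δ (π j)| ≤ |δ (π i)|) :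
    ((∃ m, 1 ≤ m ∧ m ≤ Km ∧ τ0 - c ≤ Dsum δ π m) →
      MSP {s : Finset (Fin K) | |τ0 + ∑ k ∈ s, δ k| ≤ c} =
        ((sInf {m : ℕ | 1 ≤ m ∧ m ≤ Km ∧ τ0 - c ≤ Dsum δ π m} : ℕ) : ℕ∞)) ∧
    ((¬ ∃ m, 1 ≤ m ∧ m ≤ Km ∧ τ0 - c ≤ Dsum δ π m) →
      MSP {s : Finset (Fin K) | |τ0 + ∑ k ∈ s, δ k| ≤ c} = ⊤) := by
  constructor
  · intro hex
    obtain ⟨-, hle, hD⟩ :=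
      Nat.sInf_mem (s := {m : ℕ | 1 ≤ m ∧ m ≤ Km ∧ τ0 - c ≤ Dsum δ π m}) hex
    have hlow := fun m => Nat.sInf_le (s := {m : ℕ | 1 ≤ m ∧ m ≤ Km ∧ τ0 - c ≤ Dsum δ π m}) (m := m)
    generalize sInf {m : ℕ | 1 ≤ m ∧ m ≤ Km ∧ τ0 - c ≤ Dsum δ π m} = m at *
    have hinj : Set.InjOn π (Finset.range m) := by
      intro i hi j hj hij
      simp only [Finset.coe_range, Set.mem_Iio] at hi hj
      exact hπinj i j (by omega) (by omega) hij
    apply le_antisymm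
    · refine (iInf₂_le ((Finset.range m).image π) ?_).trans ?_
      · refine abs_add_sum_image_range_le hc hτ hbound hπmem hinj hle hD fun r hr hr1 => ?_
        by_contra! h
        exact absurd (hlow r ⟨hr1, by omega, h⟩) (by omega)
      · rw [Finset.card_image_of_injOn hinj, Finset.card_range]
    · refine le_iInf₂ fun s hs => ?_
      obtain ⟨r, hr, hrs⟩ := exists_prefix_le_card hc hτ hπinj hπsurj hsort hs
      exact_mod_cast (hlow r hr).trans hrs
  · intro hno
    refine iInf₂_eq_top.mpr fun s hs => ?_
    obtain ⟨r, hr, -⟩ := exists_prefix_le_card hc hτ hπinj hπsurj hsort hs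
    exact absurd ⟨r, hr⟩ hno
end

section
/- Let a_1,…,a_K be positive integers and T a positive integer. Define the additive instance with baseline τ0 = T + 1/4, shifts δ_k = −a_k, and constant half-width c = 1/4, so τ̂(s) = T + 1/4 − Σ_{k=1}^K s_k a_k for s ∈ {0,1}^K. Then for every s ∈ {0,1}^K, |τ̂(s)| ≤ 1/4 if and only if Σ_{k=1}^K s_k a_k = T. Consequently, N(S) ≠ ∅ (equivalently MSP(S,N(S)) < ∞) if and only if the SUBSET SUM instance (a_1,…,a_K; T) has a solution, i.e., there exists I ⊆ {1,…,K} with Σ_{k∈I} a_k = T. -/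
theorem MSP_lt_top_iff {K : ℕ} (F : Set (Finset (Fin K))) : MSP F < ⊤ ↔ F.Nonempty := by
  simp only [MSP, iInf_lt_iff, ENat.natCast_lt_top, exists_prop, and_true, Set.Nonempty]

theorem abs_natCast_add_quarter_sub_natCast_le_iff (T n : ℕ) :
    |(T : ℝ) + 1 / 4 - n| ≤ 1 / 4 ↔ n = T := by
  rw [abs_le]
  constructor
  · rintro ⟨hl, hu⟩
    have hle : T ≤ n := by exact_mod_cast (by linarith : (T : ℝ) ≤ n)
    have hlt : n < T + 1 := by exact_mod_cast (by linarith : (n : ℝ) < T + 1)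
    omega
  · rintro rfl
    constructor <;> linarith

/-- SUBSET SUM reduction: with positive integers `a_1,…,a_K`, positive target `T`,
baseline `τ0 = T + 1/4`, shifts `δ_k = -a_k`, and half-width `c = 1/4`, so that
`τ̂(s) = T + 1/4 - ∑_{k∈s} a_k`, a configuration is null-compatible
(`|τ̂(s)| ≤ 1/4`) iff `∑_{k∈s} a_k = T`; consequently the null-compatible set is
nonempty (equivalently `MSP < ∞`) iff the SUBSET SUM instance has a solution. -/
theorem subset_sum_reduction {K : ℕ} (a : Fin K → ℕ) (ha : ∀ k, 0 < a k)
    (T : ℕ) (hT : 0 < T) :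
    (∀ s : Finset (Fin K),
        |(T : ℝ) + 1 / 4 - ∑ k ∈ s, (a k : ℝ)| ≤ 1 / 4 ↔ ∑ k ∈ s, a k = T) ∧
    ({s : Finset (Fin K) |
        |(T : ℝ) + 1 / 4 - ∑ k ∈ s, (a k : ℝ)| ≤ 1 / 4}.Nonempty ↔
      ∃ I : Finset (Fin K), ∑ k ∈ I, a k = T) ∧
    (MSP {s : Finset (Fin K) |
        |(T : ℝ) + 1 / 4 - ∑ k ∈ s, (a k : ℝ)| ≤ 1 / 4} < ⊤ ↔
      ∃ I : Finset (Fin K), ∑ k ∈ I, a k = T) := by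
  have key (s : Finset (Fin K)) :
      |(T : ℝ) + 1 / 4 - ∑ k ∈ s, (a k : ℝ)| ≤ 1 / 4 ↔ ∑ k ∈ s, a k = T := by
    rw [← Nat.cast_sum, abs_natCast_add_quarter_sub_natCast_le_iff]
  refine ⟨key, exists_congr key, ?_⟩
  rw [MSP_lt_top_iff]
  exact exists_congr key
end

section
/- In the additive model with τ0 > c > 0, let 𝒦⁻ = {k : τ0 δ_k < 0} be ordered so that |δ_{π(1)}| ≥ ⋯ ≥ |δ_{π(K⁻)}|, write D_r = Σ_{j=1}^r |δ_{π(j)}|, and let m be the smallest index in {1,…,K⁻} with D_m ≥ τ0 − c (assumed to exist). Then every null-compatible configuration s ∈ {0,1}^K (i.e., with |τ0 + Σ_k s_k δ_k| ≤ c) satisfies ‖s‖₀ ≥ m; in particular MSP(S, N(S)) ≥ m. -/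
/-- For a sequence decreasing on `[0, N)`, the sum over a set of indices below `N` is at most
the sum over the initial segment of the same cardinality. -/
theorem sum_le_sum_range_card_of_antitone_below {f : ℕ → ℝ} {N : ℕ}
    (hf : ∀ i j, i ≤ j → j < N → f j ≤ f i) (A : Finset ℕ) (hA : ∀ j ∈ A, j < N) :
    ∑ j ∈ A, f j ≤ ∑ j ∈ Finset.range A.card, f j := by
  induction A using Finset.induction_on_max with
  | empty => simp
  | insert a A hlt ih =>
    have ha : a ∉ A := fun h => lt_irrefl _ (hlt a h)
    have hcard : A.card ≤ a := by
      simpa using Finset.card_le_card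
        (fun x hx => Finset.mem_range.2 (hlt x hx) : A ⊆ Finset.range a)
    rw [Finset.sum_insert ha, Finset.card_insert_of_notMem ha, Finset.sum_range_succ, add_comm]
    exact add_le_add (ih fun j hj => hA j (Finset.mem_insert_of_mem hj))
      (hf _ _ hcard (hA a (Finset.mem_insert_self a A)))

theorem Dsum_mono {K : ℕ} (δ : Fin K → ℝ) (π : ℕ → Fin K) : Monotone (Dsum δ π) :=
  fun _ _ h => Finset.sum_le_sum_of_subset_of_nonneg (Finset.range_mono h)
    fun _ _ _ => abs_nonneg _

/-- The total downward shift of a configuration is at most the greedy prefix sum of its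
Hamming weight. -/
theorem neg_sum_le_Dsum_card {K : ℕ} {δ : Fin K → ℝ} {N : ℕ} {π : ℕ → Fin K}
    (hinj : ∀ i j, i < N → j < N → π i = π j → i = j)
    (hsurj : ∀ k : Fin K, δ k < 0 → ∃ j, j < N ∧ π j = k)
    (hsort : ∀ i j, i ≤ j → j < N → |δ (π j)| ≤ |δ (π i)|) (s : Finset (Fin K)) :
    -∑ k ∈ s, δ k ≤ Dsum δ π s.card := by
  classical
  set A := (Finset.range N).filter (fun j => π j ∈ s)
  have hAN : ∀ j ∈ A, j < N := fun j hj => Finset.mem_range.1 (Finset.mem_filter.1 hj).1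
  have hinjOn : Set.InjOn π A := fun i hi j hj h => hinj i j (hAN i hi) (hAN j hj) h
  have hsub : A.image π ⊆ s :=
    Finset.image_subset_iff.2 fun j hj => (Finset.mem_filter.1 hj).2
  have hneg : ∀ k ∈ s, k ∉ A.image π → -δ k ≤ 0 := by
    intro k hk hkA
    by_contra! hlt
    obtain ⟨j, hj, rfl⟩ := hsurj k (by linarith)
    exact hkA (Finset.mem_image_of_mem π (Finset.mem_filter.2 ⟨Finset.mem_range.2 hj, hk⟩))
  calc -∑ k ∈ s, δ k = ∑ k ∈ s, -δ k := (Finset.sum_neg_distrib _).symm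
    _ ≤ ∑ k ∈ A.image π, -δ k := by
        rw [← Finset.sum_sdiff hsub]
        have := Finset.sum_nonpos (s := s \ A.image π) (f := fun k => -δ k) fun k hk =>
          hneg k (Finset.mem_sdiff.1 hk).1 (Finset.mem_sdiff.1 hk).2
        linarith
    _ ≤ ∑ k ∈ A.image π, |δ k| := Finset.sum_le_sum fun k _ => neg_le_abs _
    _ = ∑ j ∈ A, |δ (π j)| := Finset.sum_image hinjOn
    _ ≤ Dsum δ π A.card :=
        sum_le_sum_range_card_of_antitone_below (f := fun j => |δ (π j)|) hsort A hAN
    _ ≤ Dsum δ π s.card := Dsum_mono δ π <| by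
        rw [← Finset.card_image_of_injOn hinjOn]
        exact Finset.card_le_card hsub

/-- Greedy lower bound: in the additive model with `τ0 > c > 0`, with the
opposing axes enumerated by `π` in decreasing order of `|δ_k|`, if `m` is the
smallest index in `{1,…,K⁻}` with `D_m ≥ τ0 - c`, then every null-compatible
configuration `s` (i.e. `|τ0 + ∑_k s_k δ_k| ≤ c`) satisfies `‖s‖₀ ≥ m`;
in particular `MSP(S,N(S)) ≥ m`. -/
theorem greedy_lower_bound {K : ℕ} (τ0 c : ℝ) (δ : Fin K → ℝ)
    (hc : 0 < c) (hτ : c < τ0)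
    (Km : ℕ) (hKm : Km = (Finset.univ.filter (fun k => τ0 * δ k < 0)).card)
    (π : ℕ → Fin K)
    (hπinj : ∀ i j, i < Km → j < Km → π i = π j → i = j)
    (hπmem : ∀ j, j < Km → τ0 * δ (π j) < 0)
    (hπsurj : ∀ k : Fin K, τ0 * δ k < 0 → ∃ j, j < Km ∧ π j = k)
    (hsort : ∀ i j, i ≤ j → j < Km → |δ (π j)| ≤ |δ (π i)|)
    (m : ℕ) (hm1 : 1 ≤ m) (hm2 : m ≤ Km)
    (hDm : τ0 - c ≤ Dsum δ π m)
    (hmin : ∀ r, 1 ≤ r → r < m → Dsum δ π r < τ0 - c) :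
    (∀ s : Finset (Fin K), |τ0 + ∑ k ∈ s, δ k| ≤ c → m ≤ s.card) ∧
      (m : ℕ∞) ≤ MSP {s : Finset (Fin K) | |τ0 + ∑ k ∈ s, δ k| ≤ c} := by
  have hτ0 : 0 < τ0 := hc.trans hτ
  have weight_ge : ∀ s : Finset (Fin K), |τ0 + ∑ k ∈ s, δ k| ≤ c → m ≤ s.card := by
    intro s hs
    by_contra! hlt
    have hle := neg_sum_le_Dsum_card hπinj
      (fun k hk => hπsurj k (mul_neg_of_pos_of_neg hτ0 hk)) hsort s
    have hshift := (abs_le.1 hs).2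
    rcases Nat.eq_zero_or_pos s.card with h0 | hpos
    · rw [h0, Dsum, Finset.sum_range_zero] at hle
      linarith
    · linarith [hmin s.card hpos hlt]
  exact ⟨weight_ge, le_iInf₂ fun s hs => Nat.cast_le.2 (weight_ge s hs)⟩
end

section
/- In the variable-width additive model with τ0 > c0 > 0, define e_k = Δc_k − δ_k, let 𝒦⁺ = {k : e_k > 0} be ordered so that e_{π(1)} ≥ ⋯ ≥ e_{π(K⁺)} > 0, write E_r = Σ_{j=1}^r e_{π(j)}, and let m be the smallest index in {1,…,K⁺} with E_m ≥ τ0 − c0 (assumed to exist). Then every configuration s ∈ {0,1}^K satisfying the upper-bound inequality τ̂(s) ≤ c(s) has ‖s‖₀ ≥ m; in particular every null-compatible configuration has at least m active axes, so MSP(S, N(S)) ≥ m. -/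
/-- Greedy prefix sum of effective shifts: `E r = ∑_{j=1}^r e_{π(j)}`
(with `π` zero-indexed). -/
def Esum {K : ℕ} (e : Fin K → ℝ) (π : ℕ → Fin K) (r : ℕ) : ℝ :=
  ∑ j ∈ Finset.range r, e (π j)

/-- Among finite sets of the same cardinality, a superlevel set of `f` maximizes the sum of `f`. -/
theorem Finset.sum_le_sum_of_card_eq_of_threshold {ι : Type*} {f : ι → ℝ}
    {s u : Finset ι} (t : ℝ) (hcard : s.card = u.card) (hu : ∀ k ∈ u, t ≤ f k)
    (hu' : ∀ k ∉ u, f k ≤ t) : ∑ k ∈ s, f k ≤ ∑ k ∈ u, f k := by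
  classical
  have h : ∑ k ∈ s, (f k - t) ≤ ∑ k ∈ u, (f k - t) :=
    calc ∑ k ∈ s, (f k - t) ≤ ∑ k ∈ s, max (f k - t) 0 :=
          Finset.sum_le_sum fun k _ => le_max_left _ _
      _ ≤ ∑ k ∈ s ∪ u, max (f k - t) 0 :=
          Finset.sum_le_sum_of_subset_of_nonneg Finset.subset_union_left
            fun k _ _ => le_max_right _ _
      _ = ∑ k ∈ u, max (f k - t) 0 :=
          (Finset.sum_subset Finset.subset_union_right
            fun k _ hk => max_eq_right (sub_nonpos.2 (hu' k hk))).symm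
      _ = ∑ k ∈ u, (f k - t) :=
          Finset.sum_congr rfl fun k hk => max_eq_left (sub_nonneg.2 (hu k hk))
  simpa [Finset.sum_sub_distrib, hcard] using h

/-- If `π` lists the indices with `0 < e k` in decreasing order of `e`, then a set with fewer
elements than that list has `e`-sum at most the greedy prefix sum of the same size. -/
theorem sum_le_Esum_card {K : ℕ} {e : Fin K → ℝ} {Kp : ℕ} {π : ℕ → Fin K}
    (hπinj : ∀ i j, i < Kp → j < Kp → π i = π j → i = j)
    (hπmem : ∀ j, j < Kp → 0 < e (π j))
    (hπsurj : ∀ k : Fin K, 0 < e k → ∃ j, j < Kp ∧ π j = k)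
    (hsort : ∀ i j, i ≤ j → j < Kp → e (π j) ≤ e (π i))
    {s : Finset (Fin K)} (hs : s.card < Kp) :
    ∑ k ∈ s, e k ≤ Esum e π s.card := by
  have hinj : Set.InjOn π (Finset.range s.card : Set ℕ) := by
    intro i hi j hj hij
    simp only [Finset.coe_range, Set.mem_Iio] at hi hj
    exact hπinj i j (hi.trans hs) (hj.trans hs) hij
  rw [Esum, ← Finset.sum_image hinj]
  refine Finset.sum_le_sum_of_card_eq_of_threshold (e (π s.card)) ?_ ?_ ?_
  · rw [Finset.card_image_of_injOn hinj, Finset.card_range]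
  · intro k hk
    obtain ⟨j, hj, rfl⟩ := Finset.mem_image.1 hk
    exact hsort j _ (Finset.mem_range.1 hj).le hs
  · intro k hk
    rcases le_or_gt (e k) 0 with hneg | hpos
    · exact hneg.trans (hπmem _ hs).le
    · obtain ⟨j, hj, rfl⟩ := hπsurj k hpos
      refine hsort _ j (not_lt.1 fun hlt => hk ?_) hj
      exact Finset.mem_image_of_mem π (Finset.mem_range.2 hlt)

/-- Variable-width greedy lower bound: with `τ0 > c0 > 0`, effective shifts
`e_k = Δc_k - δ_k`, positive-shift axes `𝒦⁺ = {k : e_k > 0}` enumerated by `π`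
in decreasing order, if `m` is the smallest index in `{1,…,K⁺}` with
`E_m ≥ τ0 - c0`, then every configuration `s` with `τ̂(s) ≤ c(s)` has
`‖s‖₀ ≥ m`; in particular every null-compatible configuration has at least `m`
active axes, so `MSP(S,N(S)) ≥ m`. -/
theorem variable_width_lower_bound {K : ℕ} (τ0 c0 : ℝ) (δ Δc : Fin K → ℝ)
    (hc0 : 0 < c0) (hτ : c0 < τ0)
    (e : Fin K → ℝ) (he : ∀ k, e k = Δc k - δ k)
    (Kp : ℕ) (hKp : Kp = (Finset.univ.filter (fun k => 0 < e k)).card)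
    (π : ℕ → Fin K)
    (hπinj : ∀ i j, i < Kp → j < Kp → π i = π j → i = j)
    (hπmem : ∀ j, j < Kp → 0 < e (π j))
    (hπsurj : ∀ k : Fin K, 0 < e k → ∃ j, j < Kp ∧ π j = k)
    (hsort : ∀ i j, i ≤ j → j < Kp → e (π j) ≤ e (π i))
    (m : ℕ) (hm1 : 1 ≤ m) (hm2 : m ≤ Kp)
    (hEm : τ0 - c0 ≤ Esum e π m)
    (hmin : ∀ r, 1 ≤ r → r < m → Esum e π r < τ0 - c0) :
    (∀ s : Finset (Fin K),
        τ0 + ∑ k ∈ s, δ k ≤ c0 + ∑ k ∈ s, Δc k → m ≤ s.card) ∧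
      (m : ℕ∞) ≤ MSP {s : Finset (Fin K) |
          -(c0 + ∑ k ∈ s, Δc k) ≤ τ0 + ∑ k ∈ s, δ k ∧
            τ0 + ∑ k ∈ s, δ k ≤ c0 + ∑ k ∈ s, Δc k} := by
  have key : ∀ s : Finset (Fin K),
      τ0 + ∑ k ∈ s, δ k ≤ c0 + ∑ k ∈ s, Δc k → m ≤ s.card := by
    intro s hs
    by_contra! hlt
    have hsum : ∑ k ∈ s, e k = ∑ k ∈ s, Δc k - ∑ k ∈ s, δ k := by
      simp only [he, Finset.sum_sub_distrib]
    have hgreedy := sum_le_Esum_card hπinj hπmem hπsurj hsort (hlt.trans_le hm2)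
    have hE : Esum e π s.card < τ0 - c0 := by
      rcases Nat.eq_zero_or_pos s.card with h0 | hpos
      · simpa [h0, Esum] using hτ
      · exact hmin _ hpos hlt
    linarith
  exact ⟨key, le_iInf₂ fun s hs => Nat.cast_le.2 (key s hs.2)⟩
end

section
/- In the variable-width additive model with τ0 > c0 > 0, define e_k = Δc_k − δ_k and b_k = −δ_k − Δc_k, let 𝒦⁺ = {k : e_k > 0} be ordered so that e_{π(1)} ≥ ⋯ ≥ e_{π(K⁺)} > 0 with prefix sums E_r, and let m be the smallest index with E_m ≥ τ0 − c0 (assumed to exist), with s_g the configuration activating exactly {π(1),…,π(m)}. Assume Δc_k ≥ 0 for all k ∈ 𝒦⁺ and max_{k∈𝒦⁺} e_k ≤ 2c0. Then b_k ≤ e_k on the support of s_g (since e_k − b_k = 2Δc_k ≥ 0), and E_m = E_{m−1} + e_{π(m)} < (τ0 − c0) + 2c0 = τ0 + c0; hence Σ_k (s_g)_k b_k ≤ E_m < τ0 + c0, which is equivalent to the lower-bound condition τ̂(s_g) ≥ −c(s_g). -/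
/-- Automatic lower-bound feasibility of the greedy prefix: with `τ0 > c0 > 0`,
effective shifts `e_k = Δc_k - δ_k`, lower-bound loads `b_k = -δ_k - Δc_k`,
positive-shift axes enumerated by `π` in decreasing order of `e`, `m` the
smallest index with `E_m ≥ τ0 - c0`, and structural conditions `Δc_k ≥ 0` on
`𝒦⁺` and `max_{k∈𝒦⁺} e_k ≤ 2c0`: then `b_k ≤ e_k` on the support of the greedy
configuration `s_g`, `E_m < τ0 + c0`, hence `∑_k (s_g)_k b_k < τ0 + c0`, which
is equivalent to the lower-bound condition `τ̂(s_g) ≥ -c(s_g)`. -/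
theorem greedy_automatic_lower_bound {K : ℕ} (τ0 c0 : ℝ) (δ Δc : Fin K → ℝ)
    (hc0 : 0 < c0) (hτ : c0 < τ0)
    (e : Fin K → ℝ) (he : ∀ k, e k = Δc k - δ k)
    (b : Fin K → ℝ) (hb : ∀ k, b k = -δ k - Δc k)
    (Kp : ℕ) (hKp : Kp = (Finset.univ.filter (fun k => 0 < e k)).card)
    (π : ℕ → Fin K)
    (hπinj : ∀ i j, i < Kp → j < Kp → π i = π j → i = j)
    (hπmem : ∀ j, j < Kp → 0 < e (π j))
    (hπsurj : ∀ k : Fin K, 0 < e k → ∃ j, j < Kp ∧ π j = k)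
    (hsort : ∀ i j, i ≤ j → j < Kp → e (π j) ≤ e (π i))
    (hΔc : ∀ k, 0 < e k → 0 ≤ Δc k)
    (hstep : ∀ k, 0 < e k → e k ≤ 2 * c0)
    (m : ℕ) (hm1 : 1 ≤ m) (hm2 : m ≤ Kp)
    (hEm : τ0 - c0 ≤ Esum e π m)
    (hmin : ∀ r, 1 ≤ r → r < m → Esum e π r < τ0 - c0) :
    (∀ j, j < m → b (π j) ≤ e (π j)) ∧
      Esum e π m < τ0 + c0 ∧
      ∑ k ∈ Finset.image π (Finset.range m), b k < τ0 + c0 ∧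
      -(c0 + ∑ k ∈ Finset.image π (Finset.range m), Δc k) ≤
        τ0 + ∑ k ∈ Finset.image π (Finset.range m), δ k := by
  have hbe : ∀ j, j < m → b (π j) ≤ e (π j) := fun j hj => by
    have := hΔc _ (hπmem j (hj.trans_le hm2))
    rw [hb, he]
    linarith
  have hE : Esum e π m < τ0 + c0 := by
    obtain ⟨r, rfl⟩ : ∃ r, m = r + 1 := ⟨m - 1, by omega⟩
    have hlast := hstep _ (hπmem r (by omega))
    have hprev : Esum e π r < τ0 - c0 := by
      rcases Nat.eq_zero_or_pos r with rfl | hr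
      · simpa [Esum] using hτ
      · exact hmin r hr (by omega)
    have hsucc : Esum e π (r + 1) = Esum e π r + e (π r) := Finset.sum_range_succ _ _
    linarith
  have hload : ∑ k ∈ Finset.image π (Finset.range m), b k < τ0 + c0 := by
    rw [Finset.sum_image fun i hi j hj h => hπinj i j
      ((Finset.mem_range.mp hi).trans_le hm2) ((Finset.mem_range.mp hj).trans_le hm2) h]
    exact (Finset.sum_le_sum fun j hj => hbe j (Finset.mem_range.mp hj)).trans_lt hE
  refine ⟨hbe, hE, hload, ?_⟩
  simp only [hb, Finset.sum_sub_distrib, Finset.sum_neg_distrib] at hload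
  linarith
end

section
/- Let V_0, V_1, …, V_P be real-valued random variables on a probability space whose joint distribution is exchangeable: for every permutation σ of {0,1,…,P}, the vector (V_{σ(0)},…,V_{σ(P)}) has the same joint distribution as (V_0,…,V_P). Define the add-one Monte Carlo p-value p̂ = (1 + #{j ∈ {1,…,P} : V_j ≥ V_0})/(P+1). Then for every α ∈ [0,1], P(p̂ ≤ α) ≤ α. -/
open MeasureTheory

section UpperRank

variable {ι : Type*} [Fintype ι]

/-- The number of indices `j` with `v i ≤ v j`, the index `i` itself included. -/
noncomputable def upperRank (i : ι) (v : ι → ℝ) : ℕ :=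
  (Finset.univ.filter (fun j => v i ≤ v j)).card

lemma upperRank_comp_perm (σ : Equiv.Perm ι) (i : ι) (v : ι → ℝ) :
    upperRank i (fun j => v (σ j)) = upperRank (σ i) v :=
  Finset.card_equiv σ (by simp)

lemma measurable_upperRank (i : ι) : Measurable (upperRank i) := by
  unfold upperRank
  simp only [Finset.card_filter]
  exact Finset.measurable_sum _ fun j _ => Measurable.ite
    (measurableSet_le (measurable_pi_apply i) (measurable_pi_apply j))
    measurable_const measurable_const

lemma measurableSet_upperRank_le (i : ι) (c : ℝ) :
    MeasurableSet {v : ι → ℝ | (upperRank i v : ℝ) ≤ c} :=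
  measurableSet_le (measurable_from_top.comp (measurable_upperRank i)) measurable_const

lemma card_upperRank_le (v : ι → ℝ) {c : ℝ} (hc : 0 ≤ c) :
    ((Finset.univ.filter (fun i => (upperRank i v : ℝ) ≤ c)).card : ℝ) ≤ c := by
  obtain hS | hS := (Finset.univ.filter (fun i => (upperRank i v : ℝ) ≤ c)).eq_empty_or_nonempty
  · simpa [hS] using hc
  · obtain ⟨i, hi, hmin⟩ := Finset.exists_min_image _ v hS
    refine le_trans ?_ (Finset.mem_filter.mp hi).2
    exact_mod_cast Finset.card_le_card fun j hj =>
      Finset.mem_filter.mpr ⟨Finset.mem_univ j, hmin j hj⟩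

lemma sum_measure_upperRank_le (ν : Measure (ι → ℝ)) [IsProbabilityMeasure ν] {c : ℝ}
    (hc : 0 ≤ c) :
    ∑ i, ν {v | (upperRank i v : ℝ) ≤ c} ≤ ENNReal.ofReal c := by
  calc ∑ i, ν {v | (upperRank i v : ℝ) ≤ c}
      = ∫⁻ v, ∑ i, {v | (upperRank i v : ℝ) ≤ c}.indicator 1 v ∂ν := by
        rw [lintegral_finsetSum _ fun i _ =>
          measurable_one.indicator (measurableSet_upperRank_le i c)]
        simp only [lintegral_indicator_one (measurableSet_upperRank_le _ c)]
    _ ≤ ∫⁻ _, ENNReal.ofReal c ∂ν := by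
        refine lintegral_mono fun v => ?_
        have h := ENNReal.ofReal_le_ofReal (card_upperRank_le v hc)
        rw [ENNReal.ofReal_natCast] at h
        simpa [Set.indicator_apply] using h
    _ = ENNReal.ofReal c := by simp

/-- Under an exchangeable law, every coordinate is equally likely to have upper rank at most
`c`, and hence does so with probability at most `c / card ι`. -/
lemma card_mul_measure_upperRank_le (ν : Measure (ι → ℝ)) [IsProbabilityMeasure ν]
    (hν : ∀ σ : Equiv.Perm ι, ν.map (fun v i => v (σ i)) = ν) (i : ι) {c : ℝ} (hc : 0 ≤ c) :
    Fintype.card ι * ν {v | (upperRank i v : ℝ) ≤ c} ≤ ENNReal.ofReal c := by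
  classical
  have hconst (k : ι) : ν {v | (upperRank k v : ℝ) ≤ c} = ν {v | (upperRank i v : ℝ) ≤ c} := by
    conv_rhs => rw [← hν (Equiv.swap i k)]
    rw [Measure.map_apply (by fun_prop) (measurableSet_upperRank_le i c)]
    simp [Set.preimage, upperRank_comp_perm]
  simpa [hconst] using sum_measure_upperRank_le ν hc

end UpperRank

lemma one_add_card_eq_upperRank {ι : Type*} [Fintype ι] [DecidableEq ι] (i : ι) (v : ι → ℝ) :
    1 + (Finset.univ.filter (fun j => j ≠ i ∧ v i ≤ v j)).card = upperRank i v := by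
  have h : Finset.univ.filter (fun j => j ≠ i ∧ v i ≤ v j)
      = (Finset.univ.filter (fun j => v i ≤ v j)).erase i := by
    ext j
    simp
  rw [h, add_comm, Finset.card_erase_add_one (by simp), upperRank]

/-- Validity of the add-one Monte Carlo permutation p-value: if the statistics
`V_0, V_1, …, V_P` are jointly exchangeable (the joint distribution is invariant
under every permutation of the indices `{0,…,P}`), then the add-one p-value
`p̂ = (1 + #{j ∈ {1,…,P} : V_j ≥ V_0})/(P+1)` satisfies `P(p̂ ≤ α) ≤ α` for every
`α ∈ [0,1]`. -/
theorem add_one_pvalue_valid {Ω : Type*} [MeasurableSpace Ω]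
    (μ : Measure Ω) [IsProbabilityMeasure μ]
    (P : ℕ) (V : Fin (P + 1) → Ω → ℝ)
    (hmeas : ∀ i, Measurable (V i))
    (hexch : ∀ σ : Equiv.Perm (Fin (P + 1)),
      μ.map (fun ω => fun i => V (σ i) ω) = μ.map (fun ω => fun i => V i ω)) :
    ∀ α ∈ Set.Icc (0 : ℝ) 1,
      μ {ω |
          ((1 + (Finset.univ.filter
              (fun j : Fin (P + 1) => j ≠ 0 ∧ V 0 ω ≤ V j ω)).card : ℝ)) /
            (P + 1) ≤ α} ≤ ENNReal.ofReal α := by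
  rintro α ⟨hα, -⟩
  have hV : Measurable (fun ω => fun i => V i ω) := measurable_pi_lambda _ hmeas
  have : IsProbabilityMeasure (μ.map (fun ω => fun i => V i ω)) :=
    Measure.isProbabilityMeasure_map hV.aemeasurable
  have hP : (0 : ℝ) < P + 1 := by positivity
  have key := card_mul_measure_upperRank_le (μ.map (fun ω => fun i => V i ω))
    (fun σ => by
      rw [Measure.map_map (by fun_prop) hV]
      exact hexch σ) 0 (mul_nonneg hP.le hα)
  rw [Measure.map_apply hV (measurableSet_upperRank_le _ _), ENNReal.ofReal_mul hP.le,
    Fintype.card_fin, ← ENNReal.ofReal_natCast, Nat.cast_succ,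
    ENNReal.mul_le_mul_iff_right (by simpa using hP) ENNReal.ofReal_ne_top] at key
  convert key using 2
  ext ω
  simp only [Set.mem_ofPred_eq, Set.mem_preimage]
  rw [← one_add_card_eq_upperRank, div_le_iff₀' hP]
  push_cast
  rfl
end
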